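/- As $y \to 0^+$, $F(y) = F(0) + 2\sqrt{y} + O(y^{7/2})$. -/

import Mathlib

open Filter Asymptotics

/-- `F y = ∫_y^{1/2} (2 t^{5/2} - t^{-1/2}) / √(1 + t³) dt`. -/
noncomputable def F (y : ℝ) : ℝ :=
  ∫ t in y..(1 / 2 : ℝ),
    (2 * t ^ ((5 : ℝ) / 2) - t ^ (-(1 : ℝ) / 2)) / Real.sqrt (1 + t ^ 3)

lemma F_aux_int (a b : ℝ) (ha : 0 ≤ a) (hb : 0 ≤ b) :
    IntervalIntegrable (fun t : ℝ =>
      (2 * t ^ ((5 : ℝ) / 2) - t ^ (-(1 : ℝ) / 2)) / Real.sqrt (1 + t ^ 3))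
      MeasureTheory.volume a b := by
  simp only [div_eq_mul_inv (_ - _)]
  apply IntervalIntegrable.mul_continuousOn
  · apply IntervalIntegrable.sub
    · exact (intervalIntegral.intervalIntegrable_rpow' (by norm_num)).const_mul 2
    · exact intervalIntegral.intervalIntegrable_rpow' (by norm_num)
  · apply ContinuousOn.inv₀
    · fun_prop
    · intro t ht
      have h0 : 0 ≤ t := le_trans (le_min ha hb) ht.1
      positivity

lemma F_aux_bound (t : ℝ) (ht : 0 < t) :
    |(2 * t ^ ((5 : ℝ) / 2) - t ^ (-(1 : ℝ) / 2)) / Real.sqrt (1 + t ^ 3)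
      + t ^ (-(1 : ℝ) / 2)| ≤ 3 * t ^ ((5 : ℝ) / 2) := by
  have h5 : t ^ ((5 : ℝ) / 2) = t ^ 3 * t ^ (-(1 : ℝ) / 2) := by
    rw [← Real.rpow_natCast t 3, ← Real.rpow_add ht]
    norm_num
  rw [h5]
  have hp : 0 < t ^ (-(1 : ℝ) / 2) := Real.rpow_pos_of_pos ht _
  set p := t ^ (-(1 : ℝ) / 2)
  have hc : 0 < t ^ 3 := by positivity
  set c := t ^ 3
  have hs : 1 ≤ Real.sqrt (1 + c) := Real.one_le_sqrt.mpr (by linarith)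
  have hs2 : Real.sqrt (1 + c) ^ 2 = 1 + c := Real.sq_sqrt (by linarith)
  set s := Real.sqrt (1 + c)
  have hs0 : 0 < s := by linarith
  have e : (2 * (c * p) - p) / s + p = p * ((2 * c + (s - 1)) / s) := by
    field_simp
    ring
  have hn : 0 ≤ (2 * c + (s - 1)) / s := div_nonneg (by linarith) hs0.le
  have hle : (2 * c + (s - 1)) / s ≤ 3 * c := by
    rw [div_le_iff₀ hs0]
    nlinarith
  rw [e, abs_of_nonneg (mul_nonneg hp.le hn)]
  nlinarith

theorem F_expansion_at_zero :
    (fun y : ℝ => F y - (F 0 + 2 * Real.sqrt y))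
      =O[nhdsWithin 0 (Set.Ioi 0)] fun y : ℝ => y ^ ((7 : ℝ) / 2) := by
  apply IsBigO.of_bound 3
  filter_upwards [self_mem_nhdsWithin] with y hy
  have hy : 0 < y := hy
  have h1 := intervalIntegral.integral_add_adjacent_intervals
    (F_aux_int 0 y le_rfl hy.le) (F_aux_int y (1 / 2) hy.le (by norm_num))
  have h2 : ∫ t in (0 : ℝ)..y, t ^ (-(1 : ℝ) / 2) = 2 * Real.sqrt y := by
    rw [integral_rpow (Or.inl (by norm_num)), Real.sqrt_eq_rpow]
    norm_num
    ring
  have h3 := intervalIntegral.integral_add (F_aux_int 0 y le_rfl hy.le)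
    (intervalIntegral.intervalIntegrable_rpow' (a := 0) (b := y)
      (r := -(1 : ℝ) / 2) (by norm_num))
  have h4 := intervalIntegral.norm_integral_le_of_norm_le_const (a := 0) (b := y)
    (C := 3 * y ^ ((5 : ℝ) / 2))
    (f := fun t : ℝ => (2 * t ^ ((5 : ℝ) / 2) - t ^ (-(1 : ℝ) / 2)) / Real.sqrt (1 + t ^ 3)
      + t ^ (-(1 : ℝ) / 2)) (by
      intro t ht
      rw [Set.uIoc_of_le hy.le] at ht
      refine (F_aux_bound t ht.1).trans ?_
      have := Real.rpow_le_rpow ht.1.le ht.2 (show (0 : ℝ) ≤ 5 / 2 by norm_num)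
      linarith)
  rw [h3, h2] at h4
  have e : F y - (F 0 + 2 * Real.sqrt y) = -((∫ t in (0 : ℝ)..y,
      (2 * t ^ ((5 : ℝ) / 2) - t ^ (-(1 : ℝ) / 2)) / Real.sqrt (1 + t ^ 3))
      + 2 * Real.sqrt y) := by
    unfold F
    rw [← h1]
    ring
  have h7 : y ^ ((7 : ℝ) / 2) = y ^ ((5 : ℝ) / 2) * y := by
    rw [← Real.rpow_add_one hy.ne']
    norm_num
  rw [e, norm_neg]
  refine h4.trans ?_
  rw [h7, sub_zero, abs_of_pos hy, Real.norm_of_nonneg (by positivity)]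
  linarith
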